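/- Let N ≥ 1 and let u(N) denote the real vector space of N×N complex anti-Hermitian matrices with inner product ⟨A,B⟩ = −Tr(AB). Let A₁, A₂, Φ : ℝ² → u(N) be continuously differentiable and let A₀ : ℝ² → u(N) be a twice continuously differentiable solution on ℝ² of the static Gauss law ∂_i(∂_iA₀ + [A_i, A₀]) + [A_i, ∂_iA₀ + [A_i, A₀]] − [Φ, [A₀, Φ]] = 0 (sum over i = 1,2), whose electric energy E(A₀) = ∫_{ℝ²} [ ½ Σ_i ‖∂_iA₀ + [A_i, A₀]‖² + ½ ‖[A₀, Φ]‖² ] dx is finite, where ‖·‖ is the norm induced by ⟨·,·⟩. Then E(A₀) = 0; in particular ∂_iA₀ + [A_i, A₀] ≡ 0 for i = 1,2 and [A₀, Φ] ≡ 0 on ℝ². -/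

import Mathlib

/-!
The U(N) extension of the non-Abelian Julia–Zee theorem: for fields valued in
the Lie algebra u(N) of anti-Hermitian matrices, with inner product
⟨A,B⟩ = −Tr(AB), a finite-electric-energy solution of the static Gauss law has
E(A₀) = 0; in particular F_{i0} = ∂ᵢA₀ + [Aᵢ,A₀] ≡ 0 and [A₀,Φ] ≡ 0.
-/

open MeasureTheory Matrix
open scoped Matrix

noncomputable section

attribute [local instance] Matrix.frobeniusNormedAddCommGroup Matrix.frobeniusNormedSpace

/-- The plane ℝ². -/
abbrev Plane : Type := EuclideanSpace ℝ (Fin 2)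

/-- Square complex matrices. -/
abbrev Mat (N : ℕ) : Type := Matrix (Fin N) (Fin N) ℂ

/-- The squared norm ‖A‖² = ⟨A,A⟩ induced on u(N) by the real inner product
⟨A,B⟩ = −Tr(AB). -/
def nsq {N : ℕ} (X : Mat N) : ℝ := (-(X * X).trace).re

/-- Partial derivative of a matrix-valued field in the `i`-th coordinate
direction. -/
def pd {N : ℕ} (i : Fin 2) (f : Plane → Mat N) (x : Plane) : Mat N :=
  fderiv ℝ f x (EuclideanSpace.single i 1)

/-- The smooth cutoff `x ↦ η (R⁻¹ x)`, with `η` a fixed bump function equal to `1` on the unit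
ball and supported in the ball of radius `2`. -/
def cutoff (R : ℝ) (x : Plane) : ℝ :=
  (⟨1, 2, one_pos, one_lt_two⟩ : ContDiffBump (0 : Plane)) (R⁻¹ • x)

lemma contDiff_cutoff (R : ℝ) : ContDiff ℝ 1 (cutoff R) :=
  (ContDiffBump.contDiff _).comp (contDiff_const_smul _)

lemma cutoff_nonneg (R : ℝ) (x : Plane) : 0 ≤ cutoff R x := ContDiffBump.nonneg _

lemma cutoff_le_one (R : ℝ) (x : Plane) : cutoff R x ≤ 1 := ContDiffBump.le_one _

lemma cutoff_eq_one {R : ℝ} (hR : 0 < R) {x : Plane} (hx : ‖x‖ ≤ R) : cutoff R x = 1 := by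
  apply ContDiffBump.one_of_mem_closedBall
  rw [mem_closedBall_zero_iff, norm_smul, norm_inv, Real.norm_of_nonneg hR.le]
  exact inv_mul_le_one_of_le₀ hx hR.le

lemma cutoff_eq_zero {R : ℝ} (hR : 0 < R) {x : Plane} (hx : 2 * R ≤ ‖x‖) : cutoff R x = 0 := by
  apply ContDiffBump.zero_of_le_dist
  rw [dist_zero_right, norm_smul, norm_inv, Real.norm_of_nonneg hR.le,
    inv_mul_eq_div, le_div_iff₀ hR]
  exact hx

lemma hasCompactSupport_cutoff {R : ℝ} (hR : 0 < R) : HasCompactSupport (cutoff R) :=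
  HasCompactSupport.intro (isCompact_closedBall (0 : Plane) (2 * R)) fun x hx =>
    cutoff_eq_zero hR (by rw [mem_closedBall_zero_iff, not_le] at hx; exact hx.le)

lemma cutoff_le_cutoff {r R : ℝ} (hr : 0 < r) (hR : 2 * r ≤ R) (x : Plane) :
    cutoff r x ≤ cutoff R x := by
  rcases le_total ‖x‖ (2 * r) with h | h
  · rw [cutoff_eq_one (by linarith) (h.trans hR)]
    exact cutoff_le_one _ _
  · rw [cutoff_eq_zero hr h]
    exact cutoff_nonneg _ _

lemma fderiv_cutoff_eq_zero {R : ℝ} {x : Plane} (hx : ‖x‖ < R) :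
    fderiv ℝ (cutoff R) x = 0 := by
  have h : cutoff R =ᶠ[nhds x] fun _ => 1 := by
    filter_upwards [(isOpen_lt continuous_norm continuous_const).mem_nhds hx] with y hy
    exact cutoff_eq_one ((norm_nonneg y).trans_lt hy) (le_of_lt hy)
  rw [h.fderiv_eq, fderiv_const_apply]

lemma fderiv_cutoff (R : ℝ) (x : Plane) :
    fderiv ℝ (cutoff R) x = R⁻¹ • fderiv ℝ (cutoff 1) (R⁻¹ • x) := by
  have h : cutoff R = fun y => cutoff 1 (R⁻¹ • y) := by
    ext y
    simp [cutoff]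
  rw [h, fderiv_comp_smul]

lemma continuous_fderiv_apply {f : Plane → ℝ} (hf : ContDiff ℝ 1 f) (v : Plane) :
    Continuous fun x => fderiv ℝ f x v :=
  (hf.continuous_fderiv one_ne_zero).clm_apply continuous_const

lemma hasCompactSupport_fderiv_cutoff {R : ℝ} (hR : 0 < R) (v : Plane) :
    HasCompactSupport fun x => fderiv ℝ (cutoff R) x v :=
  (hasCompactSupport_cutoff hR).fderiv_apply ℝ v

/-- In the plane, the Dirichlet energy of the cutoff is independent of the scale. -/
lemma integral_fderiv_cutoff_sq {R : ℝ} (hR : 0 < R) (v : Plane) :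
    ∫ x, (fderiv ℝ (cutoff R) x v) ^ 2 = ∫ x, (fderiv ℝ (cutoff 1) x v) ^ 2 := by
  have h := Measure.integral_comp_inv_smul_of_nonneg volume
    (fun x : Plane => (fderiv ℝ (cutoff 1) x v) ^ 2) hR.le
  simp only [fderiv_cutoff R, _root_.smul_apply, smul_eq_mul, mul_pow,
    integral_const_mul, h, finrank_euclideanSpace, Fintype.card_fin]
  field_simp

lemma integrable_fderiv_cutoff_sq {R : ℝ} (hR : 0 < R) (v : Plane) :
    Integrable fun x => (fderiv ℝ (cutoff R) x v) ^ 2 := by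
  simp only [pow_two]
  exact ((continuous_fderiv_apply (contDiff_cutoff R) v).mul
    (continuous_fderiv_apply (contDiff_cutoff R) v)).integrable_of_hasCompactSupport
    (hasCompactSupport_fderiv_cutoff hR v).mul_right

lemma integral_cutoff_mul_fderiv_le {R δ : ℝ} (hR : 0 < R) (hδ : 0 < δ) {f : Plane → ℝ}
    (hf : ContDiff ℝ 1 f) (hint : Integrable fun x => f x ^ 2) (v : Plane) :
    ∫ x, cutoff R x * fderiv ℝ f x v ≤
      δ * (∫ x, (fderiv ℝ (cutoff 1) x v) ^ 2)
        + (4 * δ)⁻¹ * ∫ x in {x : Plane | R ≤ ‖x‖}, f x ^ 2 := by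
  have hc := contDiff_cutoff R
  have hcs := hasCompactSupport_cutoff hR
  have hd := continuous_fderiv_apply hc v
  have hi : Integrable fun x => fderiv ℝ (cutoff R) x v * f x :=
    (hd.mul hf.continuous).integrable_of_hasCompactSupport
      (hasCompactSupport_fderiv_cutoff hR v).mul_right
  have hS : MeasurableSet {x : Plane | R ≤ ‖x‖} :=
    (isClosed_le continuous_const continuous_norm).measurableSet
  rw [integral_mul_fderiv_eq_neg_fderiv_mul_of_integrable hi
    ((hc.continuous.mul (continuous_fderiv_apply hf v)).integrable_of_hasCompactSupport
      hcs.mul_right)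
    ((hc.continuous.mul hf.continuous).integrable_of_hasCompactSupport hcs.mul_right)
    (fun x _ => hc.differentiable one_ne_zero x) (fun x _ => hf.differentiable one_ne_zero x),
    ← integral_fderiv_cutoff_sq hR v, ← integral_indicator hS, ← integral_const_mul,
    ← integral_const_mul, ← integral_neg, ← integral_add
      ((integrable_fderiv_cutoff_sq hR v).const_mul _) ((hint.indicator hS).const_mul _)]
  refine integral_mono hi.neg
    (((integrable_fderiv_cutoff_sq hR v).const_mul _).add ((hint.indicator hS).const_mul _))
    fun x => ?_
  by_cases hx : R ≤ ‖x‖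
  · simp only [Set.indicator_of_mem (show x ∈ {x : Plane | R ≤ ‖x‖} from hx)]
    have := mul_nonneg (inv_nonneg.2 (by positivity : (0 : ℝ) ≤ 4 * δ))
      (sq_nonneg (2 * δ * fderiv ℝ (cutoff R) x v + f x))
    have h : (4 * δ)⁻¹ * (2 * δ * fderiv ℝ (cutoff R) x v + f x) ^ 2 =
        δ * (fderiv ℝ (cutoff R) x v) ^ 2 + (4 * δ)⁻¹ * f x ^ 2
          + fderiv ℝ (cutoff R) x v * f x := by
      field_simp
      ring
    linarith
  · simp [hx, fderiv_cutoff_eq_zero (not_le.1 hx)]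

lemma tendsto_setIntegral_norm_ge {f : Plane → ℝ} (hf : Integrable f) :
    Filter.Tendsto (fun n : ℕ => ∫ x in {x : Plane | (n : ℝ) ≤ ‖x‖}, f x)
      Filter.atTop (nhds 0) := by
  have h := tendsto_setIntegral_of_antitone (μ := volume) (f := f)
    (s := fun n : ℕ => {x : Plane | (n : ℝ) ≤ ‖x‖})
    (fun n => (isClosed_le continuous_const continuous_norm).measurableSet)
    (fun m n hmn x (hx : (n : ℝ) ≤ ‖x‖) => (Nat.cast_le.2 hmn).trans hx)
    ⟨0, hf.integrableOn⟩
  have he : ⋂ n : ℕ, {x : Plane | (n : ℝ) ≤ ‖x‖} = ∅ := by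
    refine Set.eq_empty_of_forall_notMem fun x => ?_
    simpa using exists_nat_gt ‖x‖
  simpa [he] using h

/-- A square-integrable `C¹` vector field on the plane with nonnegative divergence is
divergence-free. -/
lemma sum_fderiv_eq_zero_of_nonneg {V : Fin 2 → Plane → ℝ} (hV : ∀ i, ContDiff ℝ 1 (V i))
    (hint : ∀ i, Integrable fun x => V i x ^ 2)
    (hdiv : ∀ x, 0 ≤ ∑ i, fderiv ℝ (V i) x (EuclideanSpace.single i 1)) (x : Plane) :
    ∑ i, fderiv ℝ (V i) x (EuclideanSpace.single i 1) = 0 := by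
  have hcd : Continuous fun y => ∑ i, fderiv ℝ (V i) y (EuclideanSpace.single i 1) :=
    continuous_finsetSum _ fun i _ => continuous_fderiv_apply (hV i) _
  have hi {R : ℝ} (hR : 0 < R) : Integrable fun y => cutoff R y *
      ∑ i, fderiv ℝ (V i) y (EuclideanSpace.single i 1) :=
    ((contDiff_cutoff R).continuous.mul hcd).integrable_of_hasCompactSupport
      (hasCompactSupport_cutoff hR).mul_right
  have hnn (R : ℝ) (y : Plane) : 0 ≤ cutoff R y *
      ∑ i, fderiv ℝ (V i) y (EuclideanSpace.single i 1) :=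
    mul_nonneg (cutoff_nonneg R y) (hdiv y)
  set r : ℝ := ‖x‖ + 1
  have hr : 0 < r := by positivity
  set K := ∫ y, cutoff r y * ∑ i, fderiv ℝ (V i) y (EuclideanSpace.single i 1) with hK
  set C := ∑ i : Fin 2, ∫ y, (fderiv ℝ (cutoff 1) y (EuclideanSpace.single i 1)) ^ 2
  have hbound {δ : ℝ} (hδ : 0 < δ) : K ≤ δ * C := by
    have ht : Filter.Tendsto (fun n : ℕ => ∑ i, (δ *
        (∫ y, (fderiv ℝ (cutoff 1) y (EuclideanSpace.single i 1)) ^ 2)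
        + (4 * δ)⁻¹ * ∫ y in {y : Plane | (n : ℝ) ≤ ‖y‖}, V i y ^ 2))
        Filter.atTop (nhds (δ * C)) := by
      rw [Finset.mul_sum]
      refine tendsto_finsetSum _ fun i _ => ?_
      simpa using ((tendsto_setIntegral_norm_ge (hint i)).const_mul (4 * δ)⁻¹).const_add
        (δ * ∫ y, (fderiv ℝ (cutoff 1) y (EuclideanSpace.single i 1)) ^ 2)
    obtain ⟨m, hm⟩ := exists_nat_ge (2 * r)
    refine ge_of_tendsto ht ?_
    filter_upwards [Filter.eventually_ge_atTop m] with n hn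
    have hrn : 2 * r ≤ (n : ℝ) := hm.trans (Nat.cast_le.2 hn)
    have hn0 : (0 : ℝ) < n := by linarith
    calc K ≤ ∫ y, cutoff n y * ∑ i, fderiv ℝ (V i) y (EuclideanSpace.single i 1) :=
          integral_mono (hi hr) (hi hn0) fun y =>
            mul_le_mul_of_nonneg_right (cutoff_le_cutoff hr hrn y) (hdiv y)
      _ = ∑ i, ∫ y, cutoff n y * fderiv ℝ (V i) y (EuclideanSpace.single i 1) := by
          simp only [Finset.mul_sum]
          exact integral_finsetSum _ fun i _ => ((contDiff_cutoff n).continuous.mul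
            (continuous_fderiv_apply (hV i) _)).integrable_of_hasCompactSupport
            (hasCompactSupport_cutoff hn0).mul_right
      _ ≤ _ := Finset.sum_le_sum fun i _ =>
          integral_cutoff_mul_fderiv_le hn0 hδ (hV i) (hint i) _
  have hK0 : K = 0 := by
    refine le_antisymm ?_ (integral_nonneg (hnn r))
    have ht : Filter.Tendsto (fun δ : ℝ => δ * C) (nhdsWithin 0 (Set.Ioi 0)) (nhds 0) := by
      simpa using ((continuous_mul_const C).tendsto 0).mono_left nhdsWithin_le_nhds
    refine ge_of_tendsto ht ?_
    filter_upwards [self_mem_nhdsWithin] with δ hδ using hbound hδ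
  have hz := (((contDiff_cutoff r).continuous.mul hcd).ae_eq_iff_eq volume
    continuous_zero).1 ((integral_eq_zero_iff_of_nonneg (hnn r) (hi hr)).1 (hK.symm.trans hK0))
  simpa [cutoff_eq_one hr (show ‖x‖ ≤ r by simp [r])] using congrFun hz x

/-- The bilinear form `⟨X, Y⟩ = -Re Tr(XY)` as a continuous bilinear map. -/
def negTrace (N : ℕ) : Mat N →L[ℝ] Mat N →L[ℝ] ℝ :=
  (LinearMap.mk₂ ℝ (fun X Y : Mat N => (-(X * Y).trace).re)
    (fun X Y Z => by simp [add_mul]; ring) (fun c X Y => by simp)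
    (fun X Y Z => by simp [mul_add]; ring) (fun c X Y => by simp)).toContinuousBilinearMap

/-- The commutator as a continuous bilinear map. -/
def lieBilin (N : ℕ) : Mat N →L[ℝ] Mat N →L[ℝ] Mat N :=
  (LinearMap.mk₂ ℝ (fun X Y : Mat N => ⁅X, Y⁆)
    (fun X Y Z => by simp only [Ring.lie_def, add_mul, mul_add]; abel)
    (fun c X Y => by simp only [Ring.lie_def, smul_sub, smul_mul_assoc, mul_smul_comm])
    (fun X Y Z => by simp only [Ring.lie_def, add_mul, mul_add]; abel)
    (fun c X Y => by
      simp only [Ring.lie_def, smul_sub, smul_mul_assoc, mul_smul_comm])).toContinuousBilinearMap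

section Algebra

variable {N : ℕ}

lemma negTrace_apply (X Y : Mat N) : negTrace N X Y = (-(X * Y).trace).re := rfl

lemma negTrace_self (X : Mat N) : negTrace N X X = nsq X := rfl

lemma negTrace_comm (X Y : Mat N) : negTrace N X Y = negTrace N Y X := by
  rw [negTrace_apply, negTrace_apply, trace_mul_comm]

lemma negTrace_lie (X Y Z : Mat N) : negTrace N X ⁅Y, Z⁆ = negTrace N ⁅X, Y⁆ Z := by
  simp only [negTrace_apply, Ring.lie_def, mul_sub, sub_mul, trace_sub]
  rw [← mul_assoc, ← mul_assoc, trace_mul_cycle X Z Y]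

lemma nsq_eq_sum {X : Mat N} (hX : Xᴴ = -X) : nsq X = ∑ i, ∑ j, Complex.normSq (X i j) := by
  have h : nsq X = (X * Xᴴ).trace.re := by simp [nsq, hX]
  simp [h, trace, mul_apply, Complex.mul_conj]

lemma nsq_nonneg {X : Mat N} (hX : Xᴴ = -X) : 0 ≤ nsq X := by
  rw [nsq_eq_sum hX]
  exact Finset.sum_nonneg fun i _ => Finset.sum_nonneg fun j _ => Complex.normSq_nonneg _

lemma eq_zero_of_nsq_eq_zero {X : Mat N} (hX : Xᴴ = -X) (h : nsq X = 0) : X = 0 := by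
  have hj (i : Fin N) : 0 ≤ ∑ j, Complex.normSq (X i j) :=
    Finset.sum_nonneg fun j _ => Complex.normSq_nonneg _
  have hz := (Finset.sum_eq_zero_iff_of_nonneg fun i _ => hj i).1 ((nsq_eq_sum hX).symm.trans h)
  ext i j
  exact Complex.normSq_eq_zero.1 ((Finset.sum_eq_zero_iff_of_nonneg fun j _ =>
    Complex.normSq_nonneg _).1 (hz i (Finset.mem_univ i)) j (Finset.mem_univ j))

lemma negTrace_sq_le {X Y : Mat N} (hX : Xᴴ = -X) (hY : Yᴴ = -Y) :
    negTrace N X Y ^ 2 ≤ nsq X * nsq Y := by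
  have h := discrim_le_zero (a := nsq Y) (b := 2 * negTrace N X Y) (c := nsq X) fun t => by
    have ht : 0 ≤ nsq (X + t • Y) := nsq_nonneg (by
      rw [conjTranspose_add, conjTranspose_smul, hX, hY, star_trivial, smul_neg, neg_add])
    rw [← negTrace_self] at ht
    simp only [map_add, map_smul, _root_.add_apply, _root_.smul_apply, smul_eq_mul, negTrace_self,
      negTrace_comm Y X] at ht
    linarith
  rw [discrim] at h
  linarith

lemma conjTranspose_lie {X Y : Mat N} (hX : Xᴴ = -X) (hY : Yᴴ = -Y) : ⁅X, Y⁆ᴴ = -⁅X, Y⁆ := by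
  simp [Ring.lie_def, hX, hY]

lemma conjTranspose_pd {f : Plane → Mat N} (hf : Differentiable ℝ f) (h : ∀ x, (f x)ᴴ = -(f x))
    (i : Fin 2) (x : Plane) : (pd i f x)ᴴ = -(pd i f x) := by
  let L : Mat N →L[ℝ] Mat N := LinearMap.toContinuousLinearMap
    { toFun := fun X => Xᴴ
      map_add' := conjTranspose_add
      map_smul' := fun c X => by simp [conjTranspose_smul] }
  have hL : HasFDerivAt (fun y => L (f y)) (L.comp (fderiv ℝ f x)) x :=
    L.hasFDerivAt.comp x (hf x).hasFDerivAt
  have hn : HasFDerivAt (fun y => L (f y)) (-fderiv ℝ f x) x := by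
    have e : (fun y => L (f y)) = fun y => -f y := funext h
    rw [e]
    exact (hf x).hasFDerivAt.neg
  exact DFunLike.congr_fun (hL.unique hn) (EuclideanSpace.single i 1)

lemma pd_negTrace {f g : Plane → Mat N} (hf : Differentiable ℝ f) (hg : Differentiable ℝ g)
    (i : Fin 2) (x : Plane) :
    fderiv ℝ (fun y => negTrace N (f y) (g y)) x (EuclideanSpace.single i 1) =
      negTrace N (f x) (pd i g x) + negTrace N (pd i f x) (g x) := by
  have h := (negTrace N).hasFDerivAt_of_bilinear (hf x).hasFDerivAt (hg x).hasFDerivAt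
  exact DFunLike.congr_fun h.fderiv (EuclideanSpace.single i 1)

end Algebra

lemma fderiv_inv_sqrt_mul {u w : Plane → ℝ} {x : Plane} (hux : 0 ≤ u x)
    (hu : DifferentiableAt ℝ u x) (hw : DifferentiableAt ℝ w x) (v : Plane) :
    fderiv ℝ (fun y => (√(1 + u y))⁻¹ * w y) x v =
      (√(1 + u x))⁻¹ * fderiv ℝ w x v - fderiv ℝ u x v * w x / (2 * √(1 + u x) ^ 3) := by
  have hpos : 0 < 1 + u x := by linarith
  have hs : 0 < √(1 + u x) := Real.sqrt_pos.2 hpos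
  have hφ : HasDerivAt (fun t : ℝ => (√(1 + t))⁻¹)
      (-(1 / (2 * √(1 + u x))) / √(1 + u x) ^ 2) (u x) :=
    (((hasDerivAt_id (u x)).const_add 1).sqrt hpos.ne').inv hs.ne'
  have h := (hφ.comp_hasFDerivAt x hu.hasFDerivAt).mul hw.hasFDerivAt
  refine (DFunLike.congr_fun h.fderiv v).trans ?_
  simp only [_root_.add_apply, _root_.smul_apply, smul_eq_mul, Function.comp_apply]
  field_simp
  ring

lemma ContinuousLinearMap.contDiff_apply_apply {E F G H : Type*}
    [NormedAddCommGroup E] [NormedSpace ℝ E] [NormedAddCommGroup F] [NormedSpace ℝ F]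
    [NormedAddCommGroup G] [NormedSpace ℝ G] [NormedAddCommGroup H] [NormedSpace ℝ H]
    {n : WithTop ℕ∞} (B : F →L[ℝ] G →L[ℝ] H) {f : E → F} {g : E → G}
    (hf : ContDiff ℝ n f) (hg : ContDiff ℝ n g) : ContDiff ℝ n fun x => B (f x) (g x) :=
  (B.contDiff.comp hf).clm_apply hg

section Gauss

variable {N : ℕ}

/-- The temporal field strength `F_{i0} = ∂ᵢA₀ + [Aᵢ, A₀]`. -/
def fieldStrength (A : Fin 2 → Plane → Mat N) (A₀ : Plane → Mat N) (i : Fin 2) (x : Plane) :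
    Mat N :=
  pd i A₀ x + ⁅A i x, A₀ x⁆

variable {A : Fin 2 → Plane → Mat N} {Φ A₀ : Plane → Mat N}

lemma contDiff_fieldStrength (hA : ∀ i, ContDiff ℝ 1 (A i)) (hA₀ : ContDiff ℝ 2 A₀)
    (i : Fin 2) : ContDiff ℝ 1 (fieldStrength A A₀ i) := by
  have h₁ : ContDiff ℝ 1 (pd i A₀) := (hA₀.fderiv_right le_rfl).clm_apply contDiff_const
  have h₂ : ContDiff ℝ 1 fun x => lieBilin N (A i x) (A₀ x) :=
    (lieBilin N).contDiff_apply_apply (hA i) (hA₀.of_le one_le_two)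
  exact h₁.add h₂

lemma conjTranspose_fieldStrength (hA : ∀ i x, (A i x)ᴴ = -(A i x))
    (hA₀ : ∀ x, (A₀ x)ᴴ = -(A₀ x)) (hd : Differentiable ℝ A₀) (i : Fin 2) (x : Plane) :
    (fieldStrength A A₀ i x)ᴴ = -(fieldStrength A A₀ i x) := by
  rw [fieldStrength, conjTranspose_add, conjTranspose_pd hd hA₀,
    conjTranspose_lie (hA i x) (hA₀ x), neg_add]

lemma contDiff_negTrace {f g : Plane → Mat N} (hf : ContDiff ℝ 1 f) (hg : ContDiff ℝ 1 g) :
    ContDiff ℝ 1 fun x => negTrace N (f x) (g x) :=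
  (negTrace N).contDiff_apply_apply hf hg

lemma negTrace_self_pd (i : Fin 2) (x : Plane) :
    negTrace N (A₀ x) (pd i A₀ x) = negTrace N (A₀ x) (fieldStrength A A₀ i x) := by
  have h : ⁅A₀ x, A₀ x⁆ = 0 := by simp [Ring.lie_def]
  rw [fieldStrength, map_add, negTrace_comm _ ⁅A i x, A₀ x⁆, ← negTrace_lie, h, map_zero,
    add_zero]

/-- The vector field `⟨A₀, F_{i0}⟩ / √(1 + ‖A₀‖²)`. -/
def gaussField (A : Fin 2 → Plane → Mat N) (A₀ : Plane → Mat N) (i : Fin 2) (x : Plane) : ℝ :=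
  (√(1 + nsq (A₀ x)))⁻¹ * negTrace N (A₀ x) (fieldStrength A A₀ i x)

lemma contDiff_gaussField (hA : ∀ i, ContDiff ℝ 1 (A i)) (hA₀ : ContDiff ℝ 2 A₀)
    (hA₀u : ∀ x, (A₀ x)ᴴ = -(A₀ x)) (i : Fin 2) : ContDiff ℝ 1 (gaussField A A₀ i) := by
  have h₁ := hA₀.of_le one_le_two
  have hpos (x : Plane) : 0 < 1 + nsq (A₀ x) := by linarith [nsq_nonneg (hA₀u x)]
  exact (((contDiff_const.add (contDiff_negTrace h₁ h₁)).sqrt fun x => (hpos x).ne').inv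
    fun x => (Real.sqrt_pos.2 (hpos x)).ne').mul
    (contDiff_negTrace h₁ (contDiff_fieldStrength hA hA₀ i))

lemma gaussField_sq_le (hA : ∀ i x, (A i x)ᴴ = -(A i x)) (hA₀ : ∀ x, (A₀ x)ᴴ = -(A₀ x))
    (hd : Differentiable ℝ A₀) (i : Fin 2) (x : Plane) :
    gaussField A A₀ i x ^ 2 ≤ nsq (fieldStrength A A₀ i x) := by
  have hF := conjTranspose_fieldStrength hA hA₀ hd i x
  have h₀ := nsq_nonneg (hA₀ x)
  have hpos : 0 < 1 + nsq (A₀ x) := by linarith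
  rw [gaussField, mul_pow, inv_pow, Real.sq_sqrt hpos.le, inv_mul_le_iff₀ hpos]
  linarith [negTrace_sq_le (hA₀ x) hF, nsq_nonneg hF]

lemma sum_fderiv_gaussField_ge (hAu : ∀ i x, (A i x)ᴴ = -(A i x))
    (hA₀u : ∀ x, (A₀ x)ᴴ = -(A₀ x)) (hA : ∀ i, ContDiff ℝ 1 (A i)) (hA₀ : ContDiff ℝ 2 A₀)
    (x : Plane) (heq : ∑ i, (pd i (fieldStrength A A₀ i) x + ⁅A i x, fieldStrength A A₀ i x⁆)
      - ⁅Φ x, ⁅A₀ x, Φ x⁆⁆ = 0) :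
    (∑ i, nsq (fieldStrength A A₀ i x)) / √(1 + nsq (A₀ x)) ^ 3
        + nsq ⁅A₀ x, Φ x⁆ / √(1 + nsq (A₀ x)) ≤
      ∑ i, fderiv ℝ (gaussField A A₀ i) x (EuclideanSpace.single i 1) := by
  have hd : Differentiable ℝ A₀ := hA₀.differentiable two_ne_zero
  have hF (i : Fin 2) : Differentiable ℝ (fieldStrength A A₀ i) :=
    (contDiff_fieldStrength hA hA₀ i).differentiable one_ne_zero
  have h₀ := nsq_nonneg (hA₀u x)
  have hpos : 0 < 1 + nsq (A₀ x) := by linarith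
  have hs : 0 < √(1 + nsq (A₀ x)) := Real.sqrt_pos.2 hpos
  have hs2 : √(1 + nsq (A₀ x)) ^ 2 = 1 + nsq (A₀ x) := Real.sq_sqrt hpos.le
  have hu : DifferentiableAt ℝ (fun y => nsq (A₀ y)) x :=
    (contDiff_negTrace (hA₀.of_le one_le_two) (hA₀.of_le one_le_two)).differentiable
      one_ne_zero x
  have hw (i : Fin 2) :
      DifferentiableAt ℝ (fun y => negTrace N (A₀ y) (fieldStrength A A₀ i y)) x :=
    (contDiff_negTrace (hA₀.of_le one_le_two) (contDiff_fieldStrength hA hA₀ i)).differentiable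
      one_ne_zero x
  have hdu (i : Fin 2) : fderiv ℝ (fun y => nsq (A₀ y)) x (EuclideanSpace.single i 1) =
      2 * negTrace N (A₀ x) (fieldStrength A A₀ i x) := by
    refine (pd_negTrace hd hd i x).trans ?_
    rw [negTrace_comm (pd i A₀ x), negTrace_self_pd (A := A), two_mul]
  have hdw (i : Fin 2) : fderiv ℝ (fun y => negTrace N (A₀ y) (fieldStrength A A₀ i y)) x
      (EuclideanSpace.single i 1) = nsq (fieldStrength A A₀ i x) + negTrace N (A₀ x)
        (pd i (fieldStrength A A₀ i) x + ⁅A i x, fieldStrength A A₀ i x⁆) := by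
    have hp : pd i A₀ x = fieldStrength A A₀ i x + ⁅A₀ x, A i x⁆ := by
      simp only [fieldStrength, Ring.lie_def]
      abel
    rw [pd_negTrace hd (hF i), hp, map_add, map_add, negTrace_lie, _root_.add_apply,
      negTrace_self]
    ring
  have hsum : ∑ i, fderiv ℝ (fun y => negTrace N (A₀ y) (fieldStrength A A₀ i y)) x
      (EuclideanSpace.single i 1) =
      ∑ i, nsq (fieldStrength A A₀ i x) + nsq ⁅A₀ x, Φ x⁆ := by
    simp only [hdw]
    rw [Finset.sum_add_distrib, ← map_sum, sub_eq_zero.1 heq, negTrace_lie, negTrace_self]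
  have hcs : ∑ i, negTrace N (A₀ x) (fieldStrength A A₀ i x) ^ 2 ≤
      nsq (A₀ x) * ∑ i, nsq (fieldStrength A A₀ i x) := by
    rw [Finset.mul_sum]
    exact Finset.sum_le_sum fun i _ => negTrace_sq_le (hA₀u x)
      (conjTranspose_fieldStrength hAu hA₀u hd i x)
  have hdiv : ∑ i, fderiv ℝ (gaussField A A₀ i) x (EuclideanSpace.single i 1) =
      (√(1 + nsq (A₀ x)))⁻¹ * (∑ i, nsq (fieldStrength A A₀ i x) + nsq ⁅A₀ x, Φ x⁆)
      - (∑ i, negTrace N (A₀ x) (fieldStrength A A₀ i x) ^ 2) / √(1 + nsq (A₀ x)) ^ 3 := by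
    rw [← hsum, Finset.mul_sum, Finset.sum_div, ← Finset.sum_sub_distrib]
    refine Finset.sum_congr rfl fun i _ => ?_
    refine (fderiv_inv_sqrt_mul h₀ hu (hw i) _).trans ?_
    rw [hdu]
    congr 1
    field_simp
  have hle := div_le_div_of_nonneg_right hcs (pow_pos hs 3).le
  have hsplit : (√(1 + nsq (A₀ x)))⁻¹ * (∑ i, nsq (fieldStrength A A₀ i x) + nsq ⁅A₀ x, Φ x⁆) =
      (∑ i, nsq (fieldStrength A A₀ i x)) / √(1 + nsq (A₀ x)) ^ 3
        + nsq ⁅A₀ x, Φ x⁆ / √(1 + nsq (A₀ x))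
        + nsq (A₀ x) * (∑ i, nsq (fieldStrength A A₀ i x)) / √(1 + nsq (A₀ x)) ^ 3 := by
    have hn : nsq (A₀ x) = √(1 + nsq (A₀ x)) ^ 2 - 1 := by linarith
    generalize √(1 + nsq (A₀ x)) = s at *
    rw [hn]
    field_simp
    ring
  linarith

end Gauss

theorem unitary_julia_zee_energy
    (N : ℕ) (hN : 1 ≤ N)
    (A : Fin 2 → Plane → Mat N) (Φ A₀ : Plane → Mat N)
    -- the fields take values in u(N), i.e. are anti-Hermitian
    (hAu : ∀ i x, (A i x)ᴴ = -(A i x))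
    (hΦu : ∀ x, (Φ x)ᴴ = -(Φ x))
    (hA₀u : ∀ x, (A₀ x)ᴴ = -(A₀ x))
    (hA : ∀ i, ContDiff ℝ 1 (A i)) (hΦ : ContDiff ℝ 1 Φ) (hA₀' : ContDiff ℝ 2 A₀)
    -- the static Gauss law
    (heq : ∀ x, ∑ i, (pd i (fun y => pd i A₀ y + ⁅A i y, A₀ y⁆) x
        + ⁅A i x, pd i A₀ x + ⁅A i x, A₀ x⁆⁆)
        - ⁅Φ x, ⁅A₀ x, Φ x⁆⁆ = 0)
    -- finite electric energy E(A₀)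
    (hfin : Integrable (fun x =>
        (1 / 2) * ∑ i, nsq (pd i A₀ x + ⁅A i x, A₀ x⁆)
        + (1 / 2) * nsq ⁅A₀ x, Φ x⁆)) :
    (∫ x, ((1 / 2) * ∑ i, nsq (pd i A₀ x + ⁅A i x, A₀ x⁆)
        + (1 / 2) * nsq ⁅A₀ x, Φ x⁆)) = 0 ∧
    (∀ i x, pd i A₀ x + ⁅A i x, A₀ x⁆ = 0) ∧
    (∀ x, ⁅A₀ x, Φ x⁆ = 0) := by
  have hd : Differentiable ℝ A₀ := hA₀'.differentiable two_ne_zero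
  have hFu := conjTranspose_fieldStrength hAu hA₀u hd
  have hF0 (i : Fin 2) (x : Plane) : 0 ≤ nsq (fieldStrength A A₀ i x) := nsq_nonneg (hFu i x)
  have hBu (x : Plane) : ⁅A₀ x, Φ x⁆ᴴ = -⁅A₀ x, Φ x⁆ := conjTranspose_lie (hA₀u x) (hΦu x)
  have hB0 (x : Plane) : 0 ≤ nsq ⁅A₀ x, Φ x⁆ := nsq_nonneg (hBu x)
  have hs (x : Plane) : 0 < √(1 + nsq (A₀ x)) :=
    Real.sqrt_pos.2 (by linarith [nsq_nonneg (hA₀u x)])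
  have hS0 (x : Plane) : 0 ≤ ∑ i, nsq (fieldStrength A A₀ i x) :=
    Finset.sum_nonneg fun i _ => hF0 i x
  have hVc := contDiff_gaussField hA hA₀' hA₀u
  have hge (x : Plane) := sum_fderiv_gaussField_ge hAu hA₀u hA hA₀' x (heq x)
  have hint (i : Fin 2) : Integrable fun x => gaussField A A₀ i x ^ 2 := by
    refine (hfin.const_mul 2).mono' ((hVc i).continuous.pow 2).aestronglyMeasurable
      (Filter.Eventually.of_forall fun x => ?_)
    have h₁ : nsq (fieldStrength A A₀ i x) ≤ ∑ j, nsq (fieldStrength A A₀ j x) :=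
      Finset.single_le_sum (f := fun j => nsq (fieldStrength A A₀ j x))
        (fun j _ => hF0 j x) (Finset.mem_univ i)
    have h₂ : ∑ j, nsq (fieldStrength A A₀ j x) =
      ∑ j, nsq (pd j A₀ x + ⁅A j x, A₀ x⁆) := rfl
    rw [Real.norm_of_nonneg (sq_nonneg _)]
    linarith [gaussField_sq_le hAu hA₀u hd i x, hB0 x]
  have hzero (x : Plane) :
      (∑ i, nsq (fieldStrength A A₀ i x)) / √(1 + nsq (A₀ x)) ^ 3 = 0 ∧
        nsq ⁅A₀ x, Φ x⁆ / √(1 + nsq (A₀ x)) = 0 := by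
    have h₁ (y : Plane) := div_nonneg (hS0 y) (pow_pos (hs y) 3).le
    have h₂ (y : Plane) := div_nonneg (hB0 y) (hs y).le
    have h := sum_fderiv_eq_zero_of_nonneg hVc hint
      (fun y => (add_nonneg (h₁ y) (h₂ y)).trans (hge y)) x
    constructor <;> linarith [h₁ x, h₂ x, hge x]
  have hF (i : Fin 2) (x : Plane) : pd i A₀ x + ⁅A i x, A₀ x⁆ = 0 := by
    have h := (div_eq_zero_iff.1 (hzero x).1).resolve_right (pow_pos (hs x) 3).ne'
    exact eq_zero_of_nsq_eq_zero (hFu i x)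
      ((Finset.sum_eq_zero_iff_of_nonneg fun j _ => hF0 j x).1 h i (Finset.mem_univ i))
  have hB (x : Plane) : ⁅A₀ x, Φ x⁆ = 0 := eq_zero_of_nsq_eq_zero (hBu x)
    ((div_eq_zero_iff.1 (hzero x).2).resolve_right (hs x).ne')
  refine ⟨?_, hF, hB⟩
  simp [hF, hB, nsq]

end
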